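/- arXiv:1102.1274 — 4 statements merged into one kernel-verified Lean document; each statement's English description precedes it below -/
import Mathlib

section
/- Let ν : ℝ³×ℝ → ℝ³ be smooth, with arguments written (γ,s), and define μ : ℝ³×ℝ³ → ℝ³ by μ(M,γ) = ν(γ, M·γ). Then Π_μ satisfies the Jacobi identity if and only if the Jacobi condition equation γ · curl_γ ν(γ,s) + ν(γ,s) · ( γ × ∂₄ν(γ,s) ) = 0 holds for all (γ,s) ∈ ℝ³×ℝ, where curl_γ is the curl of ν(·,s) in the γ-variables at fixed s and ∂₄ν is the partial derivative of ν with respect to the fourth variable s. -/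
open Matrix

noncomputable section

/-- ℝ³ as triples of reals. -/
abbrev V3 : Type := Fin 3 → ℝ

/-- The cross product on ℝ³. -/
def cross3 (a b : V3) : V3 :=
  ![a 1 * b 2 - a 2 * b 1, a 2 * b 0 - a 0 * b 2, a 0 * b 1 - a 1 * b 0]

/-- The hat map: `hat v` is the skew 3×3 matrix with `hat v * u = v × u`. -/
def hat (v : V3) : Matrix (Fin 3) (Fin 3) ℝ :=
  !![0, -(v 2), v 1; v 2, 0, -(v 0); -(v 1), v 0, 0]

/-- The matrix field Π_μ on ℝ⁶ = ℝ³ × ℝ³, in block form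
`[[hat (M + μ(M,γ)), hat γ], [hat γ, 0]]`. -/
def Pim (μ : V3 × V3 → V3) (p : V3 × V3) :
    Matrix (Fin 3 ⊕ Fin 3) (Fin 3 ⊕ Fin 3) ℝ :=
  Matrix.fromBlocks (hat (p.1 + μ p)) (hat p.2) (hat p.2) 0

/-- The coordinate directions of ℝ⁶ = ℝ³ × ℝ³ (coordinates `(M₁,M₂,M₃,γ₁,γ₂,γ₃)`). -/
def dir : Fin 3 ⊕ Fin 3 → V3 × V3
  | Sum.inl i => (Pi.single i 1, 0)
  | Sum.inr i => (0, Pi.single i 1)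

/-- Π_μ satisfies the Jacobi identity:
`Σ_l (Π^{li} ∂_l Π^{jk} + Π^{lj} ∂_l Π^{ki} + Π^{lk} ∂_l Π^{ij}) = 0` at every point. -/
def JacobiIdentity (μ : V3 × V3 → V3) : Prop :=
  ∀ p : V3 × V3, ∀ i j k : Fin 3 ⊕ Fin 3,
    ∑ l : Fin 3 ⊕ Fin 3,
      (Pim μ p l i * fderiv ℝ (fun q => Pim μ q j k) p (dir l)
        + Pim μ p l j * fderiv ℝ (fun q => Pim μ q k i) p (dir l)
        + Pim μ p l k * fderiv ℝ (fun q => Pim μ q i j) p (dir l)) = 0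

/-- The full gradient ∇C ∈ ℝ⁶ of a function on ℝ³ × ℝ³. -/
def gradFull (C : V3 × V3 → ℝ) (p : V3 × V3) : Fin 3 ⊕ Fin 3 → ℝ :=
  fun l => fderiv ℝ C p (dir l)

/-- `C` is a Casimir of Π_μ : `Π_μ(M,γ) ∇C(M,γ) = 0` everywhere. -/
def IsCasimir (μ : V3 × V3 → V3) (C : V3 × V3 → ℝ) : Prop :=
  ∀ p : V3 × V3, Pim μ p *ᵥ gradFull C p = 0

/-- Gradient in the M-variables (γ fixed) of a function on ℝ³ × ℝ³. -/
def gradM (f : V3 × V3 → ℝ) (p : V3 × V3) : V3 :=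
  fun i => fderiv ℝ f p (Pi.single i 1, 0)

/-- Gradient in the γ-variables (M fixed) of a function on ℝ³ × ℝ³. -/
def gradG (f : V3 × V3 → ℝ) (p : V3 × V3) : V3 :=
  fun i => fderiv ℝ f p (0, Pi.single i 1)

/-- Curl in the M-variables (γ fixed) of a vector field on ℝ³ × ℝ³. -/
def curlM (F : V3 × V3 → V3) (p : V3 × V3) : V3 :=
  ![gradM (fun q => F q 2) p 1 - gradM (fun q => F q 1) p 2,
    gradM (fun q => F q 0) p 2 - gradM (fun q => F q 2) p 0,
    gradM (fun q => F q 1) p 0 - gradM (fun q => F q 0) p 1]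

/-- Curl in the γ-variables (M fixed) of a vector field on ℝ³ × ℝ³. -/
def curlG (F : V3 × V3 → V3) (p : V3 × V3) : V3 :=
  ![gradG (fun q => F q 2) p 1 - gradG (fun q => F q 1) p 2,
    gradG (fun q => F q 0) p 2 - gradG (fun q => F q 2) p 0,
    gradG (fun q => F q 1) p 0 - gradG (fun q => F q 0) p 1]

/-- Gradient of a function on ℝ³. -/
def grad3 (f : V3 → ℝ) (γ : V3) : V3 :=
  fun i => fderiv ℝ f γ (Pi.single i 1)

/-- Curl of a vector field on ℝ³. -/
def curl3 (F : V3 → V3) (γ : V3) : V3 :=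
  ![grad3 (fun x => F x 2) γ 1 - grad3 (fun x => F x 1) γ 2,
    grad3 (fun x => F x 0) γ 2 - grad3 (fun x => F x 2) γ 0,
    grad3 (fun x => F x 1) γ 0 - grad3 (fun x => F x 0) γ 1]

/-- Divergence of a vector field on ℝ³. -/
def div3 (F : V3 → V3) (γ : V3) : ℝ :=
  ∑ i : Fin 3, grad3 (fun x => F x i) γ i

/-- For functions of (γ, s) ∈ ℝ³ × ℝ : gradient in γ at fixed s. -/
def gradg (f : V3 × ℝ → ℝ) (q : V3 × ℝ) : V3 :=
  fun i => fderiv ℝ f q (Pi.single i 1, 0)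

/-- For vector fields of (γ, s) ∈ ℝ³ × ℝ : curl in γ at fixed s. -/
def curlg (F : V3 × ℝ → V3) (q : V3 × ℝ) : V3 :=
  ![gradg (fun x => F x 2) q 1 - gradg (fun x => F x 1) q 2,
    gradg (fun x => F x 0) q 2 - gradg (fun x => F x 2) q 0,
    gradg (fun x => F x 1) q 0 - gradg (fun x => F x 0) q 1]

/-- ∂₄: partial derivative with respect to the fourth variable s, for a vector field ν(γ,s). -/
def d4 (F : V3 × ℝ → V3) (q : V3 × ℝ) : V3 :=
  fun k => fderiv ℝ (fun x => F x k) q (0, 1)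

/-- ∂₄: partial derivative with respect to the fourth variable s, for a scalar function D(γ,s). -/
def d4s (f : V3 × ℝ → ℝ) (q : V3 × ℝ) : ℝ :=
  fderiv ℝ f q (0, 1)

/-- The derivative of the coordinate `M_i`. -/
lemma hasFDerivAt_fst_apply (p : V3 × V3) (i : Fin 3) :
    HasFDerivAt (fun q : V3 × V3 => q.1 i)
      ((ContinuousLinearMap.proj i).comp (ContinuousLinearMap.fst ℝ V3 V3)) p :=
  ((ContinuousLinearMap.proj (R := ℝ) (φ := fun _ : Fin 3 => ℝ) i).comp
    (ContinuousLinearMap.fst ℝ V3 V3)).hasFDerivAt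

/-- The derivative of the coordinate `γ_i`. -/
lemma hasFDerivAt_snd_apply (p : V3 × V3) (i : Fin 3) :
    HasFDerivAt (fun q : V3 × V3 => q.2 i)
      ((ContinuousLinearMap.proj i).comp (ContinuousLinearMap.snd ℝ V3 V3)) p :=
  ((ContinuousLinearMap.proj (R := ℝ) (φ := fun _ : Fin 3 => ℝ) i).comp
    (ContinuousLinearMap.snd ℝ V3 V3)).hasFDerivAt

/-- A derivative of a function of `(γ, s)` in terms of its partial derivatives. -/
lemma fderiv_apply_eq_gradg (f : V3 × ℝ → ℝ) (q : V3 × ℝ) (v : V3) (t : ℝ) :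
    fderiv ℝ f q (v, t) = v ⬝ᵥ gradg f q + t * fderiv ℝ f q (0, 1) := by
  have hv : ((v, t) : V3 × ℝ) =
      ∑ i, v i • ((Pi.single i 1, 0) : V3 × ℝ) + t • ((0, 1) : V3 × ℝ) := by
    ext i
    · fin_cases i <;> simp [Fin.sum_univ_three]
    · simp [Fin.sum_univ_three]
  rw [hv, map_add, map_sum, map_smul]
  simp only [map_smul, smul_eq_mul, dotProduct, gradg]

/-- The chain rule for the `k`-th component of `(M, γ) ↦ ν (γ, M ⬝ᵥ γ)`. -/
lemma differentiableAt_and_fderiv_comp_dotProduct {ν : V3 × ℝ → V3}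
    (hν : Differentiable ℝ ν) (p : V3 × V3) (k : Fin 3) :
    DifferentiableAt ℝ (fun q : V3 × V3 => ν (q.2, q.1 ⬝ᵥ q.2) k) p ∧
    ∀ v : V3 × V3, fderiv ℝ (fun q : V3 × V3 => ν (q.2, q.1 ⬝ᵥ q.2) k) p v =
      v.2 ⬝ᵥ gradg (fun x => ν x k) (p.2, p.1 ⬝ᵥ p.2)
        + (v.1 ⬝ᵥ p.2 + p.1 ⬝ᵥ v.2) * d4 ν (p.2, p.1 ⬝ᵥ p.2) k := by
  have hk : Differentiable ℝ fun x => ν x k := differentiable_pi.1 hν k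
  have hM := hasFDerivAt_fst_apply p
  have hG := hasFDerivAt_snd_apply p
  have hdot := HasFDerivAt.fun_sum (u := Finset.univ) fun i _ => (hM i).mul (hG i)
  have h := (hk (p.2, p.1 ⬝ᵥ p.2)).hasFDerivAt.comp p (hasFDerivAt_snd.prodMk hdot)
  refine ⟨h.differentiableAt, fun v => ?_⟩
  refine (congrArg (fun L => L v) h.fderiv).trans ?_
  rw [ContinuousLinearMap.comp_apply, ContinuousLinearMap.prod_apply, fderiv_apply_eq_gradg]
  congr 2
  simp [dotProduct, Fin.sum_univ_three]
  ring

/-- The derivative of an entry of `Π_μ` for `μ (M, γ) = ν (γ, M ⬝ᵥ γ)`. -/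
lemma fderiv_Pim_apply {ν : V3 × ℝ → V3} (hν : Differentiable ℝ ν) (p v : V3 × V3)
    (j k : Fin 3 ⊕ Fin 3) :
    fderiv ℝ (fun q => Pim (fun p => ν (p.2, p.1 ⬝ᵥ p.2)) q j k) p v =
      Matrix.fromBlocks
        (hat (v.1 + fun m => v.2 ⬝ᵥ gradg (fun x => ν x m) (p.2, p.1 ⬝ᵥ p.2)
          + (v.1 ⬝ᵥ p.2 + p.1 ⬝ᵥ v.2) * d4 ν (p.2, p.1 ⬝ᵥ p.2) m))
        (hat v.2) (hat v.2) 0 j k := by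
  have hM := hasFDerivAt_fst_apply p
  have hG (i : Fin 3) : fderiv ℝ (fun q : V3 × V3 => q.2 i) p v = v.2 i := by
    rw [(hasFDerivAt_snd_apply p i).fderiv]
    rfl
  have hA (i : Fin 3) : fderiv ℝ (fun q : V3 × V3 => q.1 i + ν (q.2, q.1 ⬝ᵥ q.2) i) p v =
      v.1 i + (v.2 ⬝ᵥ gradg (fun x => ν x i) (p.2, p.1 ⬝ᵥ p.2)
        + (v.1 ⬝ᵥ p.2 + p.1 ⬝ᵥ v.2) * d4 ν (p.2, p.1 ⬝ᵥ p.2) i) := by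
    obtain ⟨hd, hv⟩ := differentiableAt_and_fderiv_comp_dotProduct hν p i
    rw [fderiv_fun_add (hM i).differentiableAt hd, _root_.add_apply, hv, (hM i).fderiv]
    rfl
  rcases j with j | j <;> rcases k with k | k <;> fin_cases j <;> fin_cases k <;>
    simp [Pim, hat, fderiv_fun_neg, hG, hA, -neg_add_rev]

/-- The left-hand side of the Jacobi condition equation at `(γ, s)`. -/
def jacobiCondition (ν : V3 × ℝ → V3) (q : V3 × ℝ) : ℝ :=
  q.1 ⬝ᵥ curlg ν q + ν q ⬝ᵥ cross3 q.1 (d4 ν q)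

set_option maxHeartbeats 1000000 in
/-- The Jacobiator of `Π_μ` vanishes except on three `M`-indices, where it is the Levi-Civita
symbol times the Jacobi condition. -/
lemma jacobiator_eq {ν : V3 × ℝ → V3} (hν : Differentiable ℝ ν) (p : V3 × V3)
    (i j k : Fin 3 ⊕ Fin 3) :
    ∑ l : Fin 3 ⊕ Fin 3,
      (Pim (fun p => ν (p.2, p.1 ⬝ᵥ p.2)) p l i
          * fderiv ℝ (fun q => Pim (fun p => ν (p.2, p.1 ⬝ᵥ p.2)) q j k) p (dir l)
        + Pim (fun p => ν (p.2, p.1 ⬝ᵥ p.2)) p l j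
          * fderiv ℝ (fun q => Pim (fun p => ν (p.2, p.1 ⬝ᵥ p.2)) q k i) p (dir l)
        + Pim (fun p => ν (p.2, p.1 ⬝ᵥ p.2)) p l k
          * fderiv ℝ (fun q => Pim (fun p => ν (p.2, p.1 ⬝ᵥ p.2)) q i j) p (dir l)) =
      Sum.elim (fun a => Sum.elim (fun b => Sum.elim
        (fun c => (Pi.single a 1 ⬝ᵥ cross3 (Pi.single b 1) (Pi.single c 1)) *
          jacobiCondition ν (p.2, p.1 ⬝ᵥ p.2)) 0 k) 0 j) 0 i := by
  simp only [fderiv_Pim_apply hν, jacobiCondition, curlg]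
  generalize d4 ν (p.2, p.1 ⬝ᵥ p.2) = D
  generalize hg : (fun m => gradg (fun x => ν x m) (p.2, p.1 ⬝ᵥ p.2)) = g
  have hg' (m : Fin 3) : gradg (fun x => ν x m) (p.2, p.1 ⬝ᵥ p.2) = g m := congrFun hg m
  simp only [hg', Pim]
  generalize ν (p.2, p.1 ⬝ᵥ p.2) = n
  obtain ⟨M, γ⟩ := p
  rcases i with i | i <;> rcases j with j | j <;> rcases k with k | k <;>
    simp [dir, dotProduct, Fin.sum_univ_three] <;>
    fin_cases i <;> fin_cases j <;> fin_cases k <;>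
    simp [hat, cross3] <;> ring

/-- For μ(M,γ) = ν(γ, M·γ), Π_μ satisfies the Jacobi identity iff the Jacobi condition
equation γ·curl_γ ν + ν·(γ × ∂₄ν) = 0 holds everywhere. -/
theorem statement2 (ν : V3 × ℝ → V3) (hν : ContDiff ℝ (⊤ : ℕ∞) ν) :
    JacobiIdentity (fun p => ν (p.2, p.1 ⬝ᵥ p.2)) ↔
      ∀ (γ : V3) (s : ℝ),
        γ ⬝ᵥ curlg ν (γ, s) + ν (γ, s) ⬝ᵥ cross3 γ (d4 ν (γ, s)) = 0 := by
  have hd : Differentiable ℝ ν := hν.differentiable (by simp)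
  constructor
  · intro h γ s
    by_cases hγ : γ = 0
    · simp [hγ, cross3, dotProduct, Fin.sum_univ_three]
    · have hne : γ ⬝ᵥ γ ≠ 0 := by simpa using hγ
      have hs : ((s / (γ ⬝ᵥ γ)) • γ) ⬝ᵥ γ = s := by
        rw [smul_dotProduct, smul_eq_mul, div_mul_cancel₀ _ hne]
      have h0 := h ((s / (γ ⬝ᵥ γ)) • γ, γ) (Sum.inl 0) (Sum.inl 1) (Sum.inl 2)
      rw [jacobiator_eq hd, hs] at h0
      simpa [jacobiCondition, cross3, dotProduct, Fin.sum_univ_three] using h0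
  · intro h p i j k
    have hp : jacobiCondition ν (p.2, p.1 ⬝ᵥ p.2) = 0 := h _ _
    rw [jacobiator_eq hd, hp]
    rcases i with i | i <;> rcases j with j | j <;> rcases k with k | k <;> simp
end
end

section
/- Let ψ : ℝ³ → ℝ and φ : ℝ³ → ℝ be smooth and define μ : ℝ³ → ℝ³ by μ(γ) = ψ(γ)γ + ∇_γφ(γ). Then γ · curl_γ μ(γ) = 0 for all γ ∈ ℝ³; consequently, the matrix field Π_μ (with μ regarded as a function of (M,γ) independent of M) satisfies the Jacobi identity. -/
open Matrix

noncomputable section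

lemma fderiv_hat_apply {E : Type*} [NormedAddCommGroup E] [NormedSpace ℝ E]
    {G : E → V3} {G' : E →L[ℝ] V3} {p : E} (h : HasFDerivAt G G' p) (i j : Fin 3) (v : E) :
    fderiv ℝ (fun q => hat (G q) i j) p v = hat (G' v) i j := by
  have hc (k : Fin 3) : fderiv ℝ (fun q => G q k) p v = G' v k := by
    rw [(hasFDerivAt_pi'.1 h k).fderiv]; rfl
  fin_cases i <;> fin_cases j <;> simp [hat, hc, fderiv_fun_neg]

lemma fderiv_Pim_apply_s9 {F : V3 → V3} {F' : V3 →L[ℝ] V3} {p : V3 × V3}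
    (h : HasFDerivAt F F' p.2) (v : V3 × V3) (i j : Fin 3 ⊕ Fin 3) :
    fderiv ℝ (fun q => Pim (fun r => F r.2) q i j) p v =
      Matrix.fromBlocks (hat (v.1 + F' v.2)) (hat v.2) (hat v.2) 0 i j := by
  have h₁ : HasFDerivAt (fun q : V3 × V3 => q.1 + F q.2)
      (ContinuousLinearMap.fst ℝ V3 V3 + F'.comp (ContinuousLinearMap.snd ℝ V3 V3)) p :=
    hasFDerivAt_fst.add (h.comp p hasFDerivAt_snd)
  have h₂ : HasFDerivAt (fun q : V3 × V3 => q.2) (ContinuousLinearMap.snd ℝ V3 V3) p :=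
    hasFDerivAt_snd
  rcases i with i | i <;> rcases j with j | j
  · exact fderiv_hat_apply h₁ i j v
  · exact fderiv_hat_apply h₂ i j v
  · exact fderiv_hat_apply h₂ i j v
  · simp [Pim]

lemma grad3_coord_eq {F : V3 → V3} {F' : V3 →L[ℝ] V3} {γ : V3} (h : HasFDerivAt F F' γ)
    (i k : Fin 3) : grad3 (fun x => F x k) γ i = F' (Pi.single i 1) k := by
  rw [grad3, (hasFDerivAt_pi'.1 h k).fderiv]; rfl

set_option maxHeartbeats 1600000 in
/-- A vector field `F` of `γ` alone with `γ · curl F = 0` defines a Poisson structure. -/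
lemma jacobiIdentity_of_dotProduct_curl3_eq_zero {F : V3 → V3} (hF : Differentiable ℝ F)
    (hcurl : ∀ γ, γ ⬝ᵥ curl3 F γ = 0) : JacobiIdentity (fun p => F p.2) := by
  intro p i j k
  have h := (hF p.2).hasFDerivAt
  have hc := hcurl p.2
  simp only [curl3, grad3_coord_eq h, dotProduct, Fin.sum_univ_three, cons_val] at hc
  simp only [fderiv_Pim_apply_s9 h]
  simp only [Fintype.sum_sum_type, Fin.sum_univ_three, dir, Pim, map_zero, add_zero, zero_add]
  generalize fderiv ℝ F p.2 = D at hc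
  generalize F p.2 = m
  rcases i with i | i <;> rcases j with j | j <;> rcases k with k | k <;>
    simp only [fromBlocks_apply₁₁, fromBlocks_apply₁₂, fromBlocks_apply₂₁, fromBlocks_apply₂₂] <;>
    fin_cases i <;> fin_cases j <;> fin_cases k <;>
    simp [hat] <;> first | ring1 | linear_combination hc | linear_combination -hc

lemma dotProduct_curl3_smul_add_grad3 {ψ φ : V3 → ℝ} (hψ : Differentiable ℝ ψ)
    (hφ : ContDiff ℝ 2 φ) (γ : V3) :
    γ ⬝ᵥ curl3 (fun x => ψ x • x + grad3 φ x) γ = 0 := by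
  have hφ' : Differentiable ℝ (fderiv ℝ φ) :=
    (hφ.fderiv_right (m := 1) (by norm_num)).differentiable (by norm_num)
  have hsymm : IsSymmSndFDerivAt ℝ φ γ := hφ.contDiffAt.isSymmSndFDerivAt (by simp)
  have hcoord (i k : Fin 3) : grad3 (fun x => (ψ x • x + grad3 φ x) k) γ i =
      ψ γ * (Pi.single i 1 : V3) k + grad3 ψ γ i * γ k +
        fderiv ℝ (fderiv ℝ φ) γ (Pi.single i 1) (Pi.single k 1) := by
    have h₁ := (hψ γ).hasFDerivAt.mul (hasFDerivAt_apply (𝕜 := ℝ) k γ)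
    have h₂ := (hφ' γ).hasFDerivAt.clm_apply (hasFDerivAt_const (Pi.single k 1 : V3) γ)
    have h₃ := (h₁.add h₂).fderiv
    change fderiv ℝ (fun x => ψ x * x k + fderiv ℝ φ x (Pi.single k 1)) γ _ = _
    refine (congrArg (fun L : V3 →L[ℝ] ℝ => L (Pi.single i 1)) h₃).trans ?_
    simp [grad3, mul_comm]
  simp only [curl3, hcoord, dotProduct, Fin.sum_univ_three, cons_val]
  rw [hsymm.eq (Pi.single 1 1) (Pi.single 0 1), hsymm.eq (Pi.single 2 1) (Pi.single 0 1),
    hsymm.eq (Pi.single 2 1) (Pi.single 1 1)]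
  simp
  ring

/-- For μ(γ) = ψ(γ)γ + ∇_γφ(γ) one has γ·curl_γ μ = 0, and Π_μ (with μ independent of M)
satisfies the Jacobi identity. -/
theorem statement9 (ψ φ : V3 → ℝ)
    (hψ : ContDiff ℝ (⊤ : ℕ∞) ψ) (hφ : ContDiff ℝ (⊤ : ℕ∞) φ) :
    (∀ γ : V3, γ ⬝ᵥ curl3 (fun x => ψ x • x + grad3 φ x) γ = 0) ∧
    JacobiIdentity (fun p => ψ p.2 • p.2 + grad3 φ p.2) := by
  have hφ₂ : ContDiff ℝ 2 φ := contDiff_infty.1 hφ 2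
  have hψ₁ : Differentiable ℝ ψ := hψ.differentiable (by simp)
  have hcurl := dotProduct_curl3_smul_add_grad3 hψ₁ hφ₂
  refine ⟨hcurl, jacobiIdentity_of_dotProduct_curl3_eq_zero (F := fun x => ψ x • x + grad3 φ x)
    ?_ hcurl⟩
  have hgrad : Differentiable ℝ (grad3 φ) := differentiable_pi.2 fun i =>
    ((hφ₂.fderiv_right (m := 1) (by norm_num)).differentiable
      (by norm_num)).clm_apply (differentiable_const _)
  exact (hψ₁.smul differentiable_id).add hgrad
end
end

section
/- Let l : ℝ³ → ℝ³ be a smooth vector field in the variable γ and define μ(γ) = −(div_γ l(γ)) γ + ∇_γ( l(γ)·γ ). Then μ(γ) = ψ(γ)γ + ∇_γφ(γ) with ψ(γ) = −div_γ l(γ) and φ(γ) = l(γ)·γ, and consequently the function C(M,γ) = (M + l(γ))·γ is a Casimir of Π_μ, i.e. Π_μ(M,γ)∇C(M,γ) = 0 for all (M,γ) ∈ ℝ³×ℝ³. -/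
open Matrix

noncomputable section

/-- The chain rule for `C(M,γ) = (M + l(γ))·γ`, in terms of the gradient of `l(γ)·γ`. -/
theorem fderiv_add_dotProduct {l : V3 → V3} {p : V3 × V3} (hl : DifferentiableAt ℝ l p.2)
    (v : V3 × V3) :
    fderiv ℝ (fun q : V3 × V3 => (q.1 + l q.2) ⬝ᵥ q.2) p v =
      v.1 ⬝ᵥ p.2 + p.1 ⬝ᵥ v.2 + fderiv ℝ (fun x => l x ⬝ᵥ x) p.2 v.2 := by
  have hdot : DifferentiableAt ℝ (fun x => l x ⬝ᵥ x) p.2 := by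
    simp only [dotProduct]
    fun_prop
  have hlin : HasFDerivAt (fun q : V3 × V3 => q.1 ⬝ᵥ q.2)
      (∑ i : Fin 3, (p.1 i • (ContinuousLinearMap.proj i).comp (ContinuousLinearMap.snd ℝ V3 V3) +
        p.2 i • (ContinuousLinearMap.proj i).comp (ContinuousLinearMap.fst ℝ V3 V3))) p := by
    simp only [dotProduct]
    exact HasFDerivAt.fun_sum fun i _ =>
      ((ContinuousLinearMap.proj i).comp (ContinuousLinearMap.fst ℝ V3 V3)).hasFDerivAt.mul
        ((ContinuousLinearMap.proj i).comp (ContinuousLinearMap.snd ℝ V3 V3)).hasFDerivAt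
  have hsum := hlin.add (hdot.hasFDerivAt.comp p (hasFDerivAt_snd (𝕜 := ℝ)))
  have heq : (fun q : V3 × V3 => (q.1 + l q.2) ⬝ᵥ q.2) =
      (fun q : V3 × V3 => q.1 ⬝ᵥ q.2) + (fun x => l x ⬝ᵥ x) ∘ Prod.snd := by
    funext q
    simp [add_dotProduct]
  rw [heq, hsum.fderiv]
  simp [dotProduct, Fin.sum_univ_three]
  ring

theorem gradFull_add_dotProduct {l : V3 → V3} {p : V3 × V3} (hl : DifferentiableAt ℝ l p.2) :
    gradFull (fun q => (q.1 + l q.2) ⬝ᵥ q.2) p =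
      Sum.elim p.2 (p.1 + grad3 (fun x => l x ⬝ᵥ x) p.2) := by
  funext j
  rw [gradFull, fderiv_add_dotProduct hl]
  rcases j with i | i <;> simp [dir, grad3]

theorem hat_mulVec (v u : V3) : hat v *ᵥ u = cross3 v u := by
  funext i
  fin_cases i <;> simp [hat, cross3, mulVec, dotProduct, Fin.sum_univ_three] <;> ring

/-- For μ(γ) = −(div_γ l)γ + ∇_γ(l·γ): μ has the form ψγ + ∇φ with ψ = −div_γ l and
φ = l·γ, and C(M,γ) = (M + l(γ))·γ is a Casimir of Π_μ. -/
theorem statement11 (l : V3 → V3) (hl : ContDiff ℝ (⊤ : ℕ∞) l) :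
    (∀ γ : V3,
      -(div3 l γ) • γ + grad3 (fun x => l x ⬝ᵥ x) γ =
        (fun x : V3 => -(div3 l x)) γ • γ + grad3 (fun x : V3 => l x ⬝ᵥ x) γ) ∧
    IsCasimir (fun p => -(div3 l p.2) • p.2 + grad3 (fun x => l x ⬝ᵥ x) p.2)
      (fun p => (p.1 + l p.2) ⬝ᵥ p.2) := by
  refine ⟨fun _ => rfl, fun p => ?_⟩
  rw [gradFull_add_dotProduct (hl.differentiable (by simp) p.2), Pim, fromBlocks_mulVec]
  simp only [Sum.elim_comp_inl, Sum.elim_comp_inr, hat_mulVec, zero_mulVec]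
  funext j
  rcases j with i | i <;> fin_cases i <;> simp [cross3] <;> ring
end
end

section
/- Let c, N, n, n₁, n₂ be real constants, write ρ = √(γ₁²+γ₂²), and define on the open set Ω = {γ ∈ ℝ³ : γ₁²+γ₂² > 0} the functions φ(γ) = c( n + n₁γ₁ + n₂γ₂ + N/ρ )(2γ₁² + 2γ₂² + γ₃²) and ψ(γ) = −c( 5n + 7n₁γ₁ + 7n₂γ₂ + N(2(γ₁²+γ₂²) − γ₃² − 1)/ρ³ ). Define μ′ : Ω → ℝ³ by μ′(γ) = ψ(γ)γ + ∇_γφ(γ). Then the third component of μ′ equals −cγ₃( 3n + 5n₁γ₁ + 5n₂γ₂ − N(γ₃² + 1)/ρ³ ), its first two components equal c( −nγ₁ − n₁γ₁² + 2n₁γ₂² + n₁γ₃² − 3n₂γ₁γ₂ + Nγ₁/ρ³ ) and c( −nγ₂ + 2n₂γ₁² − n₂γ₂² + n₂γ₃² − 3n₁γ₁γ₂ + Nγ₂/ρ³ ) respectively, and the function I₂(M,γ) = M·γ + φ(γ) is a Casimir of Π_{μ′} on ℝ³×Ω, i.e. Π_{μ′}(M,γ)∇I₂(M,γ) = 0 for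 all M ∈ ℝ³ and γ ∈ Ω. -/
open Matrix

noncomputable section

def phi15 (c N n n1 n2 : ℝ) (γ : V3) : ℝ :=
  c * (n + n1 * γ 0 + n2 * γ 1 + N / Real.sqrt (γ 0 ^ 2 + γ 1 ^ 2)) *
    (2 * γ 0 ^ 2 + 2 * γ 1 ^ 2 + γ 2 ^ 2)

def psi15 (c N n n1 n2 : ℝ) (γ : V3) : ℝ :=
  -(c * (5 * n + 7 * n1 * γ 0 + 7 * n2 * γ 1 +
      N * (2 * (γ 0 ^ 2 + γ 1 ^ 2) - γ 2 ^ 2 - 1) / Real.sqrt (γ 0 ^ 2 + γ 1 ^ 2) ^ 3))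

/-- μ′ = ψγ + ∇_γφ on Ω = {γ : γ₁² + γ₂² > 0}. -/
def mu15 (c N n n1 n2 : ℝ) (γ : V3) : V3 :=
  psi15 c N n n1 n2 γ • γ + grad3 (phi15 c N n n1 n2) γ

/-- The derivative of `phi15` away from the axis `γ₁ = γ₂ = 0`. -/
lemma hasFDerivAt_phi15 (c N n n1 n2 : ℝ) {γ : V3} (h : 0 < γ 0 ^ 2 + γ 1 ^ 2) :
    ∃ L : V3 →L[ℝ] ℝ, HasFDerivAt (phi15 c N n n1 n2) L γ ∧ ∀ v : V3,
      L v = c * (n1 * v 0 + n2 * v 1 -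
            N * (γ 0 * v 0 + γ 1 * v 1) / Real.sqrt (γ 0 ^ 2 + γ 1 ^ 2) ^ 3) *
          (2 * γ 0 ^ 2 + 2 * γ 1 ^ 2 + γ 2 ^ 2) +
        c * (n + n1 * γ 0 + n2 * γ 1 + N / Real.sqrt (γ 0 ^ 2 + γ 1 ^ 2)) *
          (4 * γ 0 * v 0 + 4 * γ 1 * v 1 + 2 * γ 2 * v 2) := by
  have hρ : Real.sqrt (γ 0 ^ 2 + γ 1 ^ 2) ≠ 0 := (Real.sqrt_pos.2 h).ne'
  have x (i : Fin 3) := hasFDerivAt_apply (𝕜 := ℝ) i γ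
  have hinv := (hasDerivAt_inv hρ).comp_hasFDerivAt γ
    ((((x 0).pow 2).add ((x 1).pow 2)).sqrt h.ne')
  have hlin := (((x 0).const_mul n1).const_add n).add ((x 1).const_mul n2)
  have hquad := ((((x 0).pow 2).const_mul 2).add (((x 1).pow 2).const_mul 2)).add ((x 2).pow 2)
  refine ⟨_, ((hlin.add (hinv.const_mul N)).const_mul c).mul hquad, fun v => ?_⟩
  simp
  field_simp
  ring

/-- The gradient of the Casimir `M ⬝ᵥ γ + f γ` in terms of that of `f`. -/
lemma gradFull_dotProduct_add {f : V3 → ℝ} {γ : V3} (hf : DifferentiableAt ℝ f γ) (M : V3) :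
    gradFull (fun p => p.1 ⬝ᵥ p.2 + f p.2) (M, γ) = Sum.elim γ (M + grad3 f γ) := by
  have x (i : Fin 3) := (hasFDerivAt_apply (𝕜 := ℝ) i M).comp (f := Prod.fst) (M, γ)
    (hasFDerivAt_fst (F := V3))
  have y (i : Fin 3) := (hasFDerivAt_apply (𝕜 := ℝ) i γ).comp (f := Prod.snd) (M, γ)
    (hasFDerivAt_snd (E := V3))
  have hF := ((((x 0).mul (y 0)).add ((x 1).mul (y 1))).add ((x 2).mul (y 2))).add
    (HasFDerivAt.comp (M, γ) hf.hasFDerivAt hasFDerivAt_snd)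
  have hF' : HasFDerivAt (fun p : V3 × V3 => p.1 ⬝ᵥ p.2 + f p.2) _ (M, γ) :=
    hF.congr_of_eventuallyEq (.of_forall fun p => by simp [dotProduct, Fin.sum_univ_three])
  funext l
  rw [gradFull, hF'.fderiv]
  rcases l with i | i <;> fin_cases i <;> simp [dir, grad3]

lemma hat_mulVec_self (v : V3) : hat v *ᵥ v = 0 := by
  ext i
  fin_cases i <;> simp [hat, dotProduct, Fin.sum_univ_three] <;> ring

/-- For `μ = ψ γ + ∇φ`, the function `M ⬝ᵥ γ + φ γ` is a Casimir of `Pim μ`. -/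
lemma Pim_mulVec_gradFull_eq_zero {f : V3 → ℝ} {γ : V3} (hf : DifferentiableAt ℝ f γ)
    (ψ : V3 → ℝ) (M : V3) :
    Pim (fun p => ψ p.2 • p.2 + grad3 f p.2) (M, γ) *ᵥ
      gradFull (fun p => p.1 ⬝ᵥ p.2 + f p.2) (M, γ) = 0 := by
  rw [gradFull_dotProduct_add hf, Pim, fromBlocks_mulVec]
  simp only [Sum.elim_comp_inl, Sum.elim_comp_inr, hat_mulVec_self, zero_mulVec, add_zero]
  ext l
  rcases l with i | i
  · fin_cases i <;> simp [hat, dotProduct, Fin.sum_univ_three] <;> ring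
  · simp

/-- The components of μ′ = ψγ + ∇φ, and I₂(M,γ) = M·γ + φ(γ) a Casimir of Π_{μ′} on ℝ³ × Ω. -/
theorem statement15 (c N n n1 n2 : ℝ) :
    (∀ γ : V3, γ 0 ^ 2 + γ 1 ^ 2 > 0 →
      mu15 c N n n1 n2 γ 2 =
        -(c * γ 2) * (3 * n + 5 * n1 * γ 0 + 5 * n2 * γ 1 -
          N * (γ 2 ^ 2 + 1) / Real.sqrt (γ 0 ^ 2 + γ 1 ^ 2) ^ 3) ∧
      mu15 c N n n1 n2 γ 0 =
        c * (-(n * γ 0) - n1 * γ 0 ^ 2 + 2 * n1 * γ 1 ^ 2 + n1 * γ 2 ^ 2 -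
          3 * n2 * γ 0 * γ 1 + N * γ 0 / Real.sqrt (γ 0 ^ 2 + γ 1 ^ 2) ^ 3) ∧
      mu15 c N n n1 n2 γ 1 =
        c * (-(n * γ 1) + 2 * n2 * γ 0 ^ 2 - n2 * γ 1 ^ 2 + n2 * γ 2 ^ 2 -
          3 * n1 * γ 0 * γ 1 + N * γ 1 / Real.sqrt (γ 0 ^ 2 + γ 1 ^ 2) ^ 3)) ∧
    (∀ (M γ : V3), γ 0 ^ 2 + γ 1 ^ 2 > 0 →
      Pim (fun p => mu15 c N n n1 n2 p.2) (M, γ) *ᵥ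
        gradFull (fun p => p.1 ⬝ᵥ p.2 + phi15 c N n n1 n2 p.2) (M, γ) = 0) := by
  refine ⟨fun γ h => ?_, fun M γ h => ?_⟩
  · obtain ⟨L, hL, hLv⟩ := hasFDerivAt_phi15 c N n n1 n2 h
    have hρ : Real.sqrt (γ 0 ^ 2 + γ 1 ^ 2) ≠ 0 := (Real.sqrt_pos.2 h).ne'
    have hsq := Real.sq_sqrt h.le
    simp only [mu15, Pi.add_apply, Pi.smul_apply, smul_eq_mul, grad3, hL.fderiv, hLv, psi15]
    generalize Real.sqrt (γ 0 ^ 2 + γ 1 ^ 2) = ρ at *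
    have hinv : N / ρ = N * (γ 0 ^ 2 + γ 1 ^ 2) / ρ ^ 3 := by
      rw [← hsq]
      field_simp
    rw [hinv]
    refine ⟨?_, ?_, ?_⟩ <;> simp <;> ring
  · obtain ⟨L, hL, -⟩ := hasFDerivAt_phi15 c N n n1 n2 h
    exact Pim_mulVec_gradFull_eq_zero hL.differentiableAt (psi15 c N n n1 n2) M
end
end
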